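/- arXiv:2407.04683 — 5 statements merged into one kernel-verified Lean document; each statement's English description precedes it below -/
import Mathlib

section
/- For every n×n matrix D over the two-element field 𝔽₂, there exists a unipotent upper-triangular n×n matrix V over 𝔽₂ (upper-triangular with all diagonal entries equal to 1, hence invertible) such that the matrix R = D·V is reduced, i.e., any two distinct nonzero columns of R have distinct pivots. -/
/-- The pivot of a nonzero column `j` of `M` is the largest row index `i` with `M i j ≠ 0`. -/
def IsPivot {n : ℕ} (M : Matrix (Fin n) (Fin n) (ZMod 2)) (i j : Fin n) : Prop :=
  M i j ≠ 0 ∧ ∀ i' : Fin n, i < i' → M i' j = 0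

/-- A matrix is reduced if any two distinct nonzero columns have distinct pivots. -/
def Reduced {n : ℕ} (M : Matrix (Fin n) (Fin n) (ZMod 2)) : Prop :=
  ∀ j₁ j₂ i₁ i₂ : Fin n, j₁ ≠ j₂ → IsPivot M i₁ j₁ → IsPivot M i₂ j₂ → i₁ ≠ i₂

/-- A matrix is unipotent upper-triangular if it is upper-triangular with all
diagonal entries equal to `1`. -/
def UnipotentUpper {n : ℕ} (V : Matrix (Fin n) (Fin n) (ZMod 2)) : Prop :=
  (∀ i : Fin n, V i i = 1) ∧ ∀ i j : Fin n, j < i → V i j = 0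

/-- For every `n × n` matrix `D` over `𝔽₂` there exists a unipotent upper-triangular
matrix `V` such that `R = D * V` is reduced. -/
theorem exists_reduction (n : ℕ) (D : Matrix (Fin n) (Fin n) (ZMod 2)) :
    ∃ V : Matrix (Fin n) (Fin n) (ZMod 2), UnipotentUpper V ∧ Reduced (D * V) := by
  classical
  have hex : ∀ j : Fin n, ∃ k : ℕ, ∃ v : Fin n → ZMod 2, v j = 1 ∧ (∀ i, j < i → v i = 0) ∧
      ∀ i : Fin n, k ≤ i.val → (D.mulVec v) i = 0 := by
    intro j
    refine ⟨n, Pi.single j 1, by simp, ?_, ?_⟩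
    · intro i hi
      exact Pi.single_eq_of_ne hi.ne' 1
    · intro i hi
      exact absurd i.isLt (by omega)
  have hspec := fun j => Nat.find_spec (hex j)
  choose v hv1 hv0 hvk using hspec
  have hcol : ∀ i j, (D * Matrix.of (fun a b => v b a)) i j = (D.mulVec (v j)) i := by
    intro i j
    rfl
  have key : ∀ j₁ j₂ i : Fin n, j₁ < j₂ → IsPivot (D * Matrix.of (fun a b => v b a)) i j₁ →
      IsPivot (D * Matrix.of (fun a b => v b a)) i j₂ → False := by
    intro j₁ j₂ i hj ⟨h1, h1z⟩ ⟨h2, h2z⟩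
    simp only [hcol] at h1 h1z h2 h2z
    have hle : Nat.find (hex j₂) ≤ i.val := by
      apply Nat.find_min'
      refine ⟨v j₂ + v j₁, ?_, ?_, ?_⟩
      · simp [hv1, hv0 j₁ j₂ hj]
      · intro a ha
        simp [hv0 j₂ a ha, hv0 j₁ a (hj.trans ha)]
      · intro a ha
        rw [Matrix.mulVec_add, Pi.add_apply]
        rcases (Fin.le_def.mpr ha).eq_or_lt with h | h
        · subst h
          have : ∀ x y : ZMod 2, x ≠ 0 → y ≠ 0 → x + y = 0 := by decide
          exact this _ _ h2 h1
        · rw [h1z a h, h2z a h, add_zero]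
    exact h2 (hvk j₂ i hle)
  refine ⟨Matrix.of (fun a b => v b a), ⟨fun i => hv1 i, fun i j h => hv0 j i h⟩, ?_⟩
  intro j₁ j₂ i₁ i₂ hne p1 p2 he
  subst he
  rcases lt_or_gt_of_ne hne with h | h
  · exact key _ _ _ h p1 p2
  · exact key _ _ _ h p2 p1
end

section
/- Let D be an n×n matrix over 𝔽₂ and let R = D·V and R' = D·V' be two reductions of D, i.e., V and V' are unipotent upper-triangular and R, R' are reduced. Then for every column index j, column j of R is zero if and only if column j of R' is zero, and if both are nonzero then pivot_R(j) = pivot_{R'}(j). In particular, the set of pairs (i,j) with pivot_R(j) = i (the persistence pairs) does not depend on the choice of reduction. -/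
theorem exists_pivot_ge {n : ℕ} (M : Matrix (Fin n) (Fin n) (ZMod 2)) (i j : Fin n)
    (h : M i j ≠ 0) : ∃ p, i ≤ p ∧ IsPivot M p j := by
  classical
  obtain ⟨p, hp, hmax⟩ := Finset.exists_max_image
    (Finset.univ.filter fun p => M p j ≠ 0) id ⟨i, by simpa using h⟩
  simp only [Finset.mem_filter, Finset.mem_univ, true_and, id] at hp hmax
  refine ⟨p, hmax i h, hp, fun q hq => ?_⟩
  by_contra hne
  exact absurd (hmax q hne) (not_le.mpr hq)

theorem pivot_mul_ge {n : ℕ} (R U : Matrix (Fin n) (Fin n) (ZMod 2)) (hR : Reduced R)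
    (i j : Fin n) (hU : U j j = 1) (h : IsPivot R i j) :
    ∃ p, i ≤ p ∧ (R * U) p j ≠ 0 := by
  classical
  obtain ⟨p, hp, hmax⟩ := Finset.exists_max_image
    (Finset.univ.filter fun p => ∃ k, U k j ≠ 0 ∧ IsPivot R p k) id
    ⟨i, by simpa using ⟨j, by simp [hU], h⟩⟩
  simp only [Finset.mem_filter, Finset.mem_univ, true_and, id] at hp hmax
  obtain ⟨k, hk, hpk⟩ := hp
  refine ⟨p, hmax i ⟨j, by simp [hU], h⟩, ?_⟩
  rw [Matrix.mul_apply, Finset.sum_eq_single k]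
  · exact mul_ne_zero hpk.1 hk
  · intro l _ hl
    by_contra hne
    obtain ⟨q, hq, hql⟩ := exists_pivot_ge R p l (left_ne_zero_of_mul hne)
    have := hmax q ⟨l, right_ne_zero_of_mul hne, hql⟩
    exact hR l k q p hl hql hpk (le_antisymm this hq)
  · simp

theorem exists_transition {n : ℕ} (V V' : Matrix (Fin n) (Fin n) (ZMod 2))
    (hV : UnipotentUpper V) (hV' : UnipotentUpper V') :
    ∃ U : Matrix (Fin n) (Fin n) (ZMod 2), V' = V * U ∧ ∀ j, U j j = 1 := by
  have bV : V.BlockTriangular id := fun i j h => hV.2 i j h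
  have bV' : V'.BlockTriangular id := fun i j h => hV'.2 i j h
  have hdet : V.det = 1 := by
    rw [Matrix.det_of_upperTriangular bV]
    simp [hV.1]
  have hu : IsUnit V.det := by simp [hdet]
  letI := Matrix.invertibleOfIsUnitDet V hu
  have bU : (V⁻¹ * V').BlockTriangular id :=
    (Matrix.blockTriangular_inv_of_blockTriangular bV).mul bV'
  have he : V' = V * (V⁻¹ * V') := by
    rw [← Matrix.mul_assoc, Matrix.mul_nonsing_inv V hu, Matrix.one_mul]
  refine ⟨_, he, fun j => ?_⟩
  have h1 := hV'.1 j
  rw [he, Matrix.mul_apply, Finset.sum_eq_single j, hV.1 j, one_mul] at h1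
  · exact h1
  · intro l _ hl
    rcases lt_or_gt_of_ne hl with h | h
    · rw [hV.2 j l h, zero_mul]
    · rw [bU h, mul_zero]
  · simp

theorem pivot_le {n : ℕ} (D V V' : Matrix (Fin n) (Fin n) (ZMod 2))
    (hV : UnipotentUpper V) (hV' : UnipotentUpper V') (hR : Reduced (D * V))
    (i j : Fin n) (h : IsPivot (D * V) i j) : ∃ p, i ≤ p ∧ (D * V') p j ≠ 0 := by
  obtain ⟨U, rfl, hU⟩ := exists_transition V V' hV hV'
  rw [← Matrix.mul_assoc]
  exact pivot_mul_ge _ U hR i j (hU j) h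

theorem zero_of_zero {n : ℕ} (D V V' : Matrix (Fin n) (Fin n) (ZMod 2))
    (hV : UnipotentUpper V) (hV' : UnipotentUpper V') (hR : Reduced (D * V))
    (j : Fin n) (h : ∀ i, (D * V') i j = 0) (i : Fin n) : (D * V) i j = 0 := by
  by_contra hne
  obtain ⟨p, -, hp⟩ := exists_pivot_ge _ i j hne
  obtain ⟨q, -, hq⟩ := pivot_le D V V' hV hV' hR p j hp
  exact hq (h q)

theorem pivot_le_pivot {n : ℕ} (D V V' : Matrix (Fin n) (Fin n) (ZMod 2))
    (hV : UnipotentUpper V) (hV' : UnipotentUpper V') (hR : Reduced (D * V))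
    (i i' j : Fin n) (h : IsPivot (D * V) i j) (h' : IsPivot (D * V') i' j) : i ≤ i' := by
  obtain ⟨q, hq, hne⟩ := pivot_le D V V' hV hV' hR i j h
  by_contra hlt
  exact hne (h'.2 q (lt_of_lt_of_le (not_le.mp hlt) hq))

/-- Uniqueness of pivots: if `R = D * V` and `R' = D * V'` are two reductions of `D`,
then for every column `j`, column `j` of `R` is zero iff column `j` of `R'` is zero,
and if nonzero their pivots agree. -/
theorem pivots_unique (n : ℕ) (D V V' : Matrix (Fin n) (Fin n) (ZMod 2))
    (hV : UnipotentUpper V) (hV' : UnipotentUpper V')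
    (hR : Reduced (D * V)) (hR' : Reduced (D * V')) :
    ∀ j : Fin n,
      ((∀ i : Fin n, (D * V) i j = 0) ↔ (∀ i : Fin n, (D * V') i j = 0)) ∧
      ∀ i i' : Fin n, IsPivot (D * V) i j → IsPivot (D * V') i' j → i = i' := by
  intro j
  refine ⟨⟨zero_of_zero D V' V hV' hV hR' j, zero_of_zero D V V' hV hV' hR j⟩, ?_⟩
  intro i i' h h'
  exact le_antisymm (pivot_le_pivot D V V' hV hV' hR i i' j h h')
    (pivot_le_pivot D V' V hV' hV hR' i' i j h' h)
end

section
/- Let D be an n×n matrix over 𝔽₂ and R = D·V a reduction of D. For 1 ≤ i ≤ n+1 and 0 ≤ j ≤ n let r(i,j) denote the rank of the submatrix of D consisting of rows i,…,n and columns 1,…,j (with r(i,j) = 0 when the submatrix is empty, i.e., when i = n+1 or j = 0). Then for all 1 ≤ i ≤ n and 1 ≤ j ≤ n: column j of R is nonzero with pivot_R(j) = i if and only if r(i,j) − r(i+1,j) − r(i,j−1) + r(i+1,j−1) = 1. -/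
/-- `lowLeftRank D i j` is the rank of the submatrix of `D` consisting of all rows with
(0-based) index `≥ i` and all columns with (0-based) index `< j`.  In the 1-based indexing
of the paper this is the rank of the submatrix with rows `i+1,…,n` and columns `1,…,j`. -/
noncomputable def lowLeftRank {n : ℕ} (D : Matrix (Fin n) (Fin n) (ZMod 2)) (i j : ℕ) : ℕ :=
  (D.submatrix (fun a : {a : Fin n // i ≤ (a : ℕ)} => (a : Fin n))
    (fun b : {b : Fin n // (b : ℕ) < j} => (b : Fin n))).rank

lemma linInd_of_pivots {ι κ F : Type*} [Field F] [Fintype ι] [Fintype κ] [LinearOrder κ]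
    (v : ι → κ → F) (p : ι → κ) (hp : Function.Injective p)
    (h1 : ∀ b, v b (p b) ≠ 0) (h2 : ∀ b a, p b < a → v b a = 0) :
    LinearIndependent F v := by
  classical
  rw [Fintype.linearIndependent_iff]
  intro g hg
  have key : ∀ a : κ, ∀ b, p b = a → g b = 0 := by
    intro a
    induction a using WellFoundedGT.induction with
    | ind a ih =>
      intro b hb
      have h := congrFun hg a
      rw [Finset.sum_apply, Finset.sum_eq_single b] at h
      · simp only [Pi.smul_apply, smul_eq_mul, Pi.zero_apply, mul_eq_zero] at h
        rcases h with h | h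
        · exact h
        · subst hb
          exact absurd h (h1 b)
      · intro b' _ hne
        rcases lt_trichotomy (p b') a with hlt | heq | hgt
        · simp [h2 b' a hlt]
        · exact absurd (hp (heq.trans hb.symm)) hne
        · simp [ih (p b') hgt b' rfl]
      · simp
  exact fun b => key _ b rfl

lemma rank_eq_card_nonzero {ι κ F : Type*} [Field F] [Fintype ι] [Fintype κ] [LinearOrder κ]
    (A : Matrix κ ι F)
    (hA : ∀ b₁ b₂ a, A a b₁ ≠ 0 → A a b₂ ≠ 0 → (∀ a', a < a' → A a' b₁ = 0) →
      (∀ a', a < a' → A a' b₂ = 0) → b₁ = b₂) :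
    A.rank = Nat.card {b // ∃ a, A a b ≠ 0} := by
  classical
  have hex : ∀ b : {b // ∃ a, A a b ≠ 0}, ∃ a, A a b.1 ≠ 0 ∧ ∀ a', a < a' → A a' b.1 = 0 := by
    rintro ⟨b, hb⟩
    obtain ⟨a, ha⟩ := (Set.toFinite {a | A a b ≠ 0}).exists_maximal hb
    refine ⟨a, ha.1, fun a' h => ?_⟩
    by_contra hc
    exact absurd (ha.2 hc h.le) (not_le.2 h)
  choose p hp1 hp2 using hex
  have hli := linInd_of_pivots (F := F) (fun b : {b // ∃ a, A a b ≠ 0} => A.col b.1) p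
    (by
      intro b c hbc
      apply Subtype.ext
      refine hA _ _ (p b) (hp1 b) ?_ (hp2 b) ?_
      · rw [hbc]; exact hp1 c
      · rw [hbc]; exact hp2 c) hp1 hp2
  rw [Matrix.rank_eq_finrank_span_cols, Nat.card_eq_fintype_card, ← finrank_span_eq_card hli]
  suffices hs : Submodule.span F (Set.range A.col) = Submodule.span F
      (Set.range fun b : {b // ∃ a, A a b ≠ 0} => A.col b.1) by rw [hs]
  apply le_antisymm
  · rw [Submodule.span_le]
    rintro _ ⟨b, rfl⟩
    by_cases hb : ∃ a, A a b ≠ 0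
    · exact Submodule.subset_span ⟨⟨b, hb⟩, rfl⟩
    · push Not at hb
      have : A.col b = 0 := funext hb
      rw [this]; exact Submodule.zero_mem _
  · apply Submodule.span_mono
    rintro _ ⟨b, rfl⟩
    exact ⟨b.1, rfl⟩

lemma lowLeftRank_mul {n : ℕ} (D V : Matrix (Fin n) (Fin n) (ZMod 2))
    (hV : UnipotentUpper V) (i j : ℕ) : lowLeftRank (D * V) i j = lowLeftRank D i j := by
  classical
  unfold lowLeftRank
  set V' := V.submatrix (fun b : {b : Fin n // (b : ℕ) < j} => (b : Fin n))
    (fun b : {b : Fin n // (b : ℕ) < j} => (b : Fin n)) with hV'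
  have hdet : V'.det = 1 := by
    rw [Matrix.det_of_isUpperTriangular]
    · simp [hV', hV.1]
    · intro a b h
      exact hV.2 _ _ h
  rw [← Matrix.rank_mul_eq_left_of_isUnit_det V' (D.submatrix _ _) (by simp [hdet])]
  congr 1
  ext a b
  simp only [Matrix.submatrix_apply, Matrix.mul_apply, hV']
  rw [← Finset.sum_subtype (p := fun b : Fin n => (b : ℕ) < j)
    (Finset.univ.filter fun b : Fin n => (b : ℕ) < j) (by simp) (fun k => D a k * V k b)]
  symm
  apply Finset.sum_subset (Finset.filter_subset _ _)
  intro k _ hk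
  have hk' : ¬ (k : ℕ) < j := by simpa using hk
  have hb := b.2
  rw [hV.2 k b (by rw [Fin.lt_def]; omega), mul_zero]

open Classical in
lemma lowLeftRank_reduced {n : ℕ} (R : Matrix (Fin n) (Fin n) (ZMod 2)) (hR : Reduced R)
    (i j : ℕ) : lowLeftRank R i j =
      (Finset.univ.filter fun b : Fin n => (b : ℕ) < j ∧ ∃ a : Fin n, i ≤ (a : ℕ) ∧ R a b ≠ 0).card := by
  unfold lowLeftRank
  rw [rank_eq_card_nonzero, ← Fintype.card_subtype, ← Nat.card_eq_fintype_card]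
  · apply Nat.card_congr
    refine ⟨fun b => ⟨b.1.1, b.1.2, ?_⟩, fun b => ⟨⟨b.1, b.2.1⟩, ?_⟩, fun _ => rfl, fun _ => rfl⟩
    · obtain ⟨a, ha⟩ := b.2
      exact ⟨a.1, a.2, ha⟩
    · obtain ⟨a, ha, hab⟩ := b.2.2
      exact ⟨⟨a, ha⟩, hab⟩
  · intro b₁ b₂ a h1 h2 h3 h4
    by_contra hne
    have up : ∀ a' : Fin n, a.1 < a' → i ≤ (a' : ℕ) := fun a' h => a.2.trans (Fin.le_def.1 h.le)
    exact hR b₁.1 b₂.1 a.1 a.1 (fun h => hne (Subtype.ext h))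
      ⟨h1, fun a' h => h3 ⟨a', up a' h⟩ h⟩ ⟨h2, fun a' h => h4 ⟨a', up a' h⟩ h⟩ rfl

open Classical in
lemma lowLeftRank_succ {n : ℕ} (R : Matrix (Fin n) (Fin n) (ZMod 2)) (hR : Reduced R)
    (i : ℕ) (j : Fin n) : lowLeftRank R i (j + 1) =
      lowLeftRank R i j + if ∃ a : Fin n, i ≤ (a : ℕ) ∧ R a j ≠ 0 then 1 else 0 := by
  rw [lowLeftRank_reduced R hR, lowLeftRank_reduced R hR]
  split_ifs with h
  · rw [← Finset.card_insert_of_notMem (a := j) (by simp)]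
    congr 1
    ext b
    simp only [Finset.mem_filter, Finset.mem_univ, true_and, Finset.mem_insert]
    constructor
    · rintro ⟨h1, h2⟩
      rcases eq_or_ne b j with e | e
      · exact Or.inl e
      · exact Or.inr ⟨by have := Fin.val_ne_of_ne e; omega, h2⟩
    · rintro (rfl | ⟨h1, h2⟩)
      · exact ⟨by omega, h⟩
      · exact ⟨by omega, h2⟩
  · rw [add_zero]
    congr 1
    ext b
    simp only [Finset.mem_filter, Finset.mem_univ, true_and]
    constructor
    · rintro ⟨h1, h2⟩
      rcases eq_or_ne b j with e | e
      · subst e; exact absurd h2 h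
      · exact ⟨by have := Fin.val_ne_of_ne e; omega, h2⟩
    · rintro ⟨h1, h2⟩
      exact ⟨by omega, h2⟩

lemma alt_sum_iff (P Q : Prop) [Decidable P] [Decidable Q] (x y : ℕ) :
    (P ∧ ¬ Q) ↔ ((x + if P then 1 else 0 : ℕ) : ℤ) - ((y + if Q then 1 else 0 : ℕ) : ℤ)
      - (x : ℤ) + (y : ℤ) = 1 := by
  by_cases hP : P <;> by_cases hQ : Q <;> simp [hP, hQ] <;> omega

/-- Pairing lemma: in any reduction `R = D * V` of `D`, column `j` is nonzero with pivot `i`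
iff the alternating sum of ranks of the four neighbouring lower-left submatrices of `D`
equals `1`.  (Here `i j : Fin n` are 0-based, so `lowLeftRank D i (j+1)` is the paper's
`r(i+1, j+1)` with rows `i+1,…,n` and columns `1,…,j+1`.) -/
theorem pivot_iff_rank_formula (n : ℕ) (D V : Matrix (Fin n) (Fin n) (ZMod 2))
    (hV : UnipotentUpper V) (hR : Reduced (D * V)) :
    ∀ i j : Fin n,
      IsPivot (D * V) i j ↔
        (lowLeftRank D (i : ℕ) ((j : ℕ) + 1) : ℤ)
            - (lowLeftRank D ((i : ℕ) + 1) ((j : ℕ) + 1) : ℤ)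
            - (lowLeftRank D (i : ℕ) (j : ℕ) : ℤ)
            + (lowLeftRank D ((i : ℕ) + 1) (j : ℕ) : ℤ) = 1 := by
  classical
  intro i j
  simp only [← lowLeftRank_mul D V hV]
  rw [lowLeftRank_succ _ hR, lowLeftRank_succ _ hR]
  generalize D * V = R
  have h : IsPivot R i j ↔ (∃ a : Fin n, (i : ℕ) ≤ (a : ℕ) ∧ R a j ≠ 0) ∧
      ¬ (∃ a : Fin n, (i : ℕ) + 1 ≤ (a : ℕ) ∧ R a j ≠ 0) := by
    constructor
    · rintro ⟨h1, h2⟩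
      exact ⟨⟨i, le_rfl, h1⟩, fun ⟨a, ha, hab⟩ => hab (h2 a ha)⟩
    · rintro ⟨⟨a, ha, hab⟩, h2⟩
      push Not at h2
      refine ⟨?_, fun a' h => h2 a' h⟩
      rcases ha.lt_or_eq with h | h
      · exact absurd (h2 a h) hab
      · rwa [Fin.ext h]
  rw [h]
  exact alt_sum_iff _ _ _ _
end

section
/- Let D be an n×n matrix over 𝔽₂ and R = D·V a reduction of D. Then for every column index j the following are equivalent: (i) column j of R is zero; (ii) column j of D lies in the linear span of columns 1,…,j−1 of D; (iii) the rank of the submatrix of D consisting of its first j columns equals the rank of the submatrix consisting of its first j−1 columns. -/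
/-- `colRank D j` is the rank of the submatrix of `D` consisting of its first `j` columns
(0-based: columns of index `< j`). -/
noncomputable def colRank {n : ℕ} (D : Matrix (Fin n) (Fin n) (ZMod 2)) (j : ℕ) : ℕ :=
  (D.submatrix id (fun b : {b : Fin n // (b : ℕ) < j} => (b : Fin n))).rank

lemma aux_maxnz {n : ℕ} (v : Fin n → ZMod 2) (h : ∃ i, v i ≠ 0) :
    ∃ i, v i ≠ 0 ∧ ∀ i', i < i' → v i' = 0 := by
  classical
  obtain ⟨i0, h0⟩ := h
  obtain ⟨i, hi, hm⟩ := Finset.exists_max_image (Finset.univ.filter fun i => v i ≠ 0) id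
    ⟨i0, by simpa using h0⟩
  refine ⟨i, by simpa using hi, fun i' hlt => ?_⟩
  by_contra hne
  exact absurd (hm i' (by simpa using hne)) (not_le.mpr hlt)

lemma aux_reduced {n : ℕ} (R : Matrix (Fin n) (Fin n) (ZMod 2)) (hR : Reduced R)
    (w : Fin n → ZMod 2) (hw : R.mulVec w = 0) (j : Fin n) (hj : w j ≠ 0) :
    ∀ i, R i j = 0 := by
  classical
  by_contra hne
  push Not at hne
  have hp : ∀ k : {k : Fin n // w k ≠ 0 ∧ ∃ i, R i k ≠ 0}, ∃ i, IsPivot R i k :=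
    fun k => aux_maxnz (fun i => R i k) k.2.2
  choose p hp using hp
  obtain ⟨k, -, hk⟩ := Finset.exists_max_image
    (Finset.univ : Finset {k : Fin n // w k ≠ 0 ∧ ∃ i, R i k ≠ 0}) p
    ⟨⟨j, hj, hne⟩, Finset.mem_univ _⟩
  have h0 : ∑ l, R (p k) l * w l = 0 := congrFun hw (p k)
  rw [Finset.sum_eq_single k.1] at h0
  · rcases mul_eq_zero.mp h0 with h | h
    · exact (hp k).1 h
    · exact k.2.1 h
  · intro l _ hl
    by_contra hc
    have h1 : R (p k) l ≠ 0 := fun h => hc (by simp [h])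
    have h2 : w l ≠ 0 := fun h => hc (by simp [h])
    let l' : {k : Fin n // w k ≠ 0 ∧ ∃ i, R i k ≠ 0} := ⟨l, h2, _, h1⟩
    have hle := hk l' (Finset.mem_univ _)
    have hne' : p l' ≠ p k := hR l k.1 _ _ hl (hp l') (hp k)
    exact h1 ((hp l').2 _ (lt_of_le_of_ne hle hne'))
  · simp

lemma aux_span {n : ℕ} (D : Matrix (Fin n) (Fin n) (ZMod 2)) (S : Set (Fin n))
    (v : Fin n → ZMod 2) :
    v ∈ Submodule.span (ZMod 2) ((fun k : Fin n => (fun i => D i k)) '' S) ↔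
      ∃ c : Fin n → ZMod 2, (∀ k, k ∉ S → c k = 0) ∧ D.mulVec c = v := by
  classical
  constructor
  · intro h
    induction h using Submodule.span_induction with
    | mem x hx =>
      obtain ⟨k, hk, rfl⟩ := hx
      refine ⟨Pi.single k 1, fun l hl => ?_, ?_⟩
      · have : l ≠ k := fun h => hl (h ▸ hk)
        simp [this]
      · ext i; simp
    | zero => exact ⟨0, by simp, by simp⟩
    | add x y _ _ hx hy =>
      obtain ⟨c, h1, rfl⟩ := hx
      obtain ⟨d, h2, rfl⟩ := hy
      exact ⟨c + d, fun k hk => by simp [h1 k hk, h2 k hk], Matrix.mulVec_add _ _ _⟩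
    | smul a x _ hx =>
      obtain ⟨c, h1, rfl⟩ := hx
      exact ⟨a • c, fun k hk => by simp [h1 k hk], Matrix.mulVec_smul _ _ _⟩
  · rintro ⟨c, hc, rfl⟩
    have : D.mulVec c = ∑ k, c k • (fun i => D i k) := by
      ext i; simp [Matrix.mulVec, dotProduct, mul_comm]
    rw [this]
    refine Submodule.sum_mem _ fun k _ => ?_
    by_cases hk : k ∈ S
    · exact Submodule.smul_mem _ _ (Submodule.subset_span ⟨k, hk, rfl⟩)
    · simp [hc k hk]

lemma aux_rank {n : ℕ} (D : Matrix (Fin n) (Fin n) (ZMod 2)) (m : ℕ) :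
    colRank D m = Module.finrank (ZMod 2) (Submodule.span (ZMod 2)
      ((fun k : Fin n => (fun i => D i k)) '' {k : Fin n | (k : ℕ) < m})) := by
  unfold colRank
  rw [Matrix.rank_eq_finrank_span_cols]
  congr 2
  all_goals
    rw [show Set.range (D.submatrix id (fun b : {b : Fin n // (b : ℕ) < m} => (b : Fin n))).col =
      ((fun k : Fin n => (fun i => D i k)) '' {k : Fin n | (k : ℕ) < m}) from ?_]
  all_goals
    ext v
    constructor
    · rintro ⟨k, rfl⟩
      exact ⟨k.1, k.2, rfl⟩
    · rintro ⟨k, hk, rfl⟩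
      exact ⟨⟨k, hk⟩, rfl⟩

/-- In any reduction `R = D * V` of `D`, for every column `j` the following are equivalent:
(i) column `j` of `R` is zero; (ii) column `j` of `D` lies in the span of the strictly
earlier columns of `D`; (iii) the rank of the first `j` columns of `D` equals the rank of
the first `j - 1` columns. -/
theorem zero_column_characterization (n : ℕ) (D V : Matrix (Fin n) (Fin n) (ZMod 2))
    (hV : UnipotentUpper V) (hR : Reduced (D * V)) :
    ∀ j : Fin n,
      ((∀ i : Fin n, (D * V) i j = 0) ↔
        (fun i => D i j) ∈
          Submodule.span (ZMod 2)
            ((fun k : Fin n => (fun i => D i k)) '' {k : Fin n | k < j})) ∧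
      ((∀ i : Fin n, (D * V) i j = 0) ↔ colRank D ((j : ℕ) + 1) = colRank D (j : ℕ)) := by
  classical
  intro j
  have key : (∀ i : Fin n, (D * V) i j = 0) ↔
        (fun i => D i j) ∈
          Submodule.span (ZMod 2)
            ((fun k : Fin n => (fun i => D i k)) '' {k : Fin n | k < j}) := by
    rw [aux_span]
    constructor
    · intro h
      refine ⟨fun k => (Pi.single j 1 : Fin n → ZMod 2) k - V k j, fun k hk => ?_, ?_⟩
      · have hk1 : ¬ k < j := hk
        rcases (not_lt.mp hk1).eq_or_lt with rfl | hlt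
        · simp [hV.1]
        · simp [hV.2 _ _ hlt, hlt.ne']
      · have : (fun k => (Pi.single j 1 : Fin n → ZMod 2) k - V k j) = Pi.single j (1 : ZMod 2) - V.col j := rfl
        rw [this, Matrix.mulVec_sub]
        ext i
        have hi : (D.mulVec (V.col j)) i = 0 := h i
        simp [hi]
    · rintro ⟨c, hc, hD⟩
      have hdet : IsUnit V.det := by
        have : V.det = 1 := by
          rw [Matrix.det_of_isUpperTriangular (fun a b hab => hV.2 a b hab)]
          simp [hV.1]
        simp [this]
      let u : Fin n → ZMod 2 := Pi.single j 1 - c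
      let w := V⁻¹.mulVec u
      have hVw : V.mulVec w = u := by
        simp [w, Matrix.mulVec_mulVec, Matrix.mul_nonsing_inv V hdet]
      have hu : ∀ k, j < k → u k = 0 := fun k hk => by
        simp [u, hc k (not_lt.mpr hk.le), hk.ne']
      have huj : u j = 1 := by simp [u, hc j (by simp)]
      have hrow : ∀ k, (∀ l, k < l → w l = 0) → u k = w k := by
        intro k hk
        rw [← hVw]
        change ∑ l, V k l * w l = w k
        rw [Finset.sum_eq_single k]
        · simp [hV.1]
        · intro l _ hl
          rcases lt_or_gt_of_ne hl with h | h
          · simp [hV.2 _ _ h]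
          · simp [hk l h]
        · simp
      have hw : ∃ i, w i ≠ 0 := by
        by_contra hcon
        push Not at hcon
        have := hrow j (fun l _ => hcon l)
        rw [huj, hcon j] at this
        exact one_ne_zero this
      obtain ⟨k, hk, hk'⟩ := aux_maxnz w hw
      have hkj : k ≤ j := by
        by_contra hlt
        exact hk (by rw [← hrow k hk', hu k (not_le.mp hlt)])
      have hwj : w j ≠ 0 := by
        rw [← hrow j (fun l hl => hk' l (hkj.trans_lt hl)), huj]
        exact one_ne_zero
      refine aux_reduced (D * V) hR w ?_ j hwj
      rw [← Matrix.mulVec_mulVec, hVw, Matrix.mulVec_sub, hD]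
      ext i; simp
  refine ⟨key, key.trans ?_⟩
  rw [aux_rank, aux_rank]
  have e1 : {k : Fin n | (k : ℕ) < (j : ℕ) + 1} = insert j {k : Fin n | k < j} := by
    ext k
    simp only [Set.mem_ofPred_eq, Set.mem_insert_iff, Fin.lt_def, Fin.ext_iff]
    omega
  have e2 : {k : Fin n | (k : ℕ) < (j : ℕ)} = {k : Fin n | k < j} := rfl
  rw [e1, e2, Set.image_insert_eq]
  constructor
  · intro h
    rw [Submodule.span_insert_eq_span h]
  · intro h
    have := Submodule.eq_of_le_of_finrank_eq
      (Submodule.span_mono (R := ZMod 2) (Set.subset_insert (fun i => D i j)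
        ((fun k : Fin n => (fun i => D i k)) '' {k : Fin n | k < j}))) h.symm
    rw [this]
    exact Submodule.subset_span (Set.mem_insert _ _)
end

section
/- Let D₁ and D₂ be n×n matrices over 𝔽₂ with D₁·D₂ = 0, and let R₂ = D₂·V₂ be a reduction of D₂. If some column j of R₂ is nonzero with pivot_{R₂}(j) = i, then column i of D₁ lies in the linear span of columns 1,…,i−1 of D₁; consequently, in every reduction R₁ = D₁·V₁ of D₁, column i of R₁ is zero. -/
lemma exists_isPivot {n : ℕ} (M : Matrix (Fin n) (Fin n) (ZMod 2)) (r j : Fin n)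
    (h : M r j ≠ 0) : ∃ i, IsPivot M i j := by
  classical
  obtain ⟨p, hp, hmax⟩ := Finset.exists_max_image
    (Finset.univ.filter fun i => M i j ≠ 0) id ⟨r, by simpa using h⟩
  refine ⟨p, by simpa using hp, fun i' hi' => ?_⟩
  by_contra hc
  exact absurd (hmax i' (by simpa using hc)) (not_le.mpr hi')

lemma reduced_kernel {n : ℕ} (M : Matrix (Fin n) (Fin n) (ZMod 2)) (hM : Reduced M)
    (y : Fin n → ZMod 2) (hy : M.mulVec y = 0) (i : Fin n) (hi : y i ≠ 0) (r : Fin n) :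
    M r i = 0 := by
  classical
  by_contra hc
  obtain ⟨p0, hp0⟩ := exists_isPivot M r i hc
  obtain ⟨p, hp, hmax⟩ := Finset.exists_max_image
    (Finset.univ.filter fun p => ∃ k, y k ≠ 0 ∧ IsPivot M p k) id
    ⟨p0, by simpa using ⟨i, hi, hp0⟩⟩
  simp only [Finset.mem_filter, Finset.mem_univ, true_and, id] at hp hmax
  obtain ⟨k, hk, hpk⟩ := hp
  have h1 : ∑ m, M p m * y m = 0 := congrFun hy p
  rw [Finset.sum_eq_single k] at h1
  · exact mul_ne_zero hpk.1 hk h1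
  · intro m _ hmk
    by_contra hne
    have hMm := left_ne_zero_of_mul hne
    have hym := right_ne_zero_of_mul hne
    obtain ⟨q, hq⟩ := exists_isPivot M p m hMm
    have hqp := hmax q ⟨m, hym, hq⟩
    have hne' := hM m k q p hmk hq hpk
    exact hMm (hq.2 p (lt_of_le_of_ne hqp hne'))
  · simp

/-- Clearing: if `D₁ * D₂ = 0` and in some reduction `R₂ = D₂ * V₂` the column `j` is
nonzero with pivot `i`, then column `i` of `D₁` lies in the span of the strictly earlier
columns of `D₁`; consequently, in every reduction `R₁ = D₁ * V₁` of `D₁`, column `i` of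
`R₁` is zero. -/
theorem clearing (n : ℕ) (D₁ D₂ V₂ : Matrix (Fin n) (Fin n) (ZMod 2))
    (h0 : D₁ * D₂ = 0) (hV₂ : UnipotentUpper V₂) (hR₂ : Reduced (D₂ * V₂))
    (i j : Fin n) (hpiv : IsPivot (D₂ * V₂) i j) :
    ((fun r => D₁ r i) ∈
        Submodule.span (ZMod 2)
          ((fun k : Fin n => (fun r => D₁ r k)) '' {k : Fin n | k < i})) ∧
    ∀ V₁ : Matrix (Fin n) (Fin n) (ZMod 2), UnipotentUpper V₁ → Reduced (D₁ * V₁) →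
      ∀ r : Fin n, (D₁ * V₁) r i = 0 := by
  have hx0 : D₁.mulVec (fun k => (D₂ * V₂) k j) = 0 := by
    have h : D₁ * (D₂ * V₂) = 0 := by rw [← Matrix.mul_assoc, h0, Matrix.zero_mul]
    funext r
    exact congrFun (congrFun h r) j
  obtain ⟨hi, hgt⟩ := hpiv
  generalize hx : (fun k => (D₂ * V₂) k j) = x at hx0
  replace hi : x i ≠ 0 := by rw [← hx]; exact hi
  replace hgt : ∀ k, i < k → x k = 0 := by rw [← hx]; exact hgt
  constructor
  · have h1 : (fun r => D₁ r i) =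
        ∑ k ∈ Finset.univ.erase i, (-(x i)⁻¹ * x k) • (fun r => D₁ r k) := by
      funext r
      have h2 : ∑ k, D₁ r k * x k = 0 := congrFun hx0 r
      rw [← Finset.add_sum_erase _ _ (Finset.mem_univ i)] at h2
      have h3 : D₁ r i = -(x i)⁻¹ * ∑ k ∈ Finset.univ.erase i, D₁ r k * x k := by
        rw [eq_neg_of_add_eq_zero_right h2]
        field_simp
      rw [h3, Finset.mul_sum, Finset.sum_apply]
      refine Finset.sum_congr rfl fun k _ => ?_
      simp only [Pi.smul_apply, smul_eq_mul]
      ring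
    rw [h1]
    refine Submodule.sum_mem _ fun k hk => ?_
    rcases lt_or_gt_of_ne (Finset.ne_of_mem_erase hk) with h | h
    · exact Submodule.smul_mem _ _ (Submodule.subset_span ⟨k, h, rfl⟩)
    · rw [hgt k h]; simp
  · intro V₁ hV hR
    have htri : V₁.BlockTriangular id := fun a b hab => hV.2 a b hab
    have hdet : IsUnit V₁.det := by
      rw [Matrix.det_of_upperTriangular htri]; simp [hV.1]
    have : Invertible V₁ := Matrix.invertibleOfIsUnitDet V₁ hdet
    have hinv : (V₁⁻¹).BlockTriangular id :=
      Matrix.blockTriangular_inv_of_blockTriangular htri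
    have hVy : V₁.mulVec (V₁⁻¹.mulVec x) = x := by
      rw [Matrix.mulVec_mulVec, Matrix.mul_nonsing_inv _ hdet, Matrix.one_mulVec]
    have hygt : ∀ k, i < k → (V₁⁻¹.mulVec x) k = 0 := by
      intro k hk
      show ∑ m, V₁⁻¹ k m * x m = 0
      refine Finset.sum_eq_zero fun m _ => ?_
      rcases lt_or_ge m k with h | h
      · have : V₁⁻¹ k m = 0 := hinv h
        simp [this]
      · simp [hgt m (hk.trans_le h)]
    generalize V₁⁻¹.mulVec x = y at hVy hygt
    have hyi : y i ≠ 0 := by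
      have h1 : ∑ m, V₁ i m * y m = x i := congrFun hVy i
      rw [Finset.sum_eq_single i] at h1
      · rw [hV.1, one_mul] at h1
        rwa [h1]
      · intro m _ hm
        rcases lt_or_gt_of_ne hm with h | h
        · rw [hV.2 i m h, zero_mul]
        · rw [hygt m h, mul_zero]
      · simp
    refine fun r => reduced_kernel _ hR y ?_ i hyi r
    rw [← Matrix.mulVec_mulVec, hVy, hx0]
end
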